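/- Classical bound for the symmetric two-body Bell inequality −2S_0 + (1/2)S_00 − S_01 + (1/2)S_11 + 2n ≥ 0: for every n ≥ 1 and all functions m_0, m_1 : Fin n → {−1, +1}, writing S_0 = Σ_i m_0(i), S_00 = Σ_{i≠j} m_0(i)m_0(j), S_01 = Σ_{i≠j} m_0(i)m_1(j), S_11 = Σ_{i≠j} m_1(i)m_1(j) (sums over ordered pairs of distinct indices), one has −2·S_0 + (1/2)·S_00 − S_01 + (1/2)·S_11 + 2n ≥ 0. -/

import Mathlib

/-- Symmetrized one-body correlator `S_k = ∑_i m_k(i)` of a deterministic local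
strategy. -/
def oneBodySym (n : ℕ) (m : Fin n → ℤ) : ℝ := ∑ i, (m i : ℝ)

/-- Symmetrized two-body correlator `S_kl = ∑_{i≠j} m_k(i) m_l(j)` (sum over
ordered pairs of distinct indices) of a deterministic local strategy. -/
def twoBodySym (n : ℕ) (m m' : Fin n → ℤ) : ℝ :=
  ∑ i, ∑ j, if i = j then 0 else (m i : ℝ) * (m' j : ℝ)

/-- The two-body correlator is the product of the one-body correlators minus the diagonal. -/
lemma twoBodySym_eq (n : ℕ) (m m' : Fin n → ℤ) :
    twoBodySym n m m' = oneBodySym n m * oneBodySym n m' - ∑ i, (m i : ℝ) * (m' i : ℝ) := by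
  unfold twoBodySym oneBodySym
  rw [Finset.sum_mul_sum, ← Finset.sum_sub_distrib]
  refine Finset.sum_congr rfl fun i _ => ?_
  have hdiag : (m i : ℝ) * m' i = ∑ j, if i = j then (m i : ℝ) * m' j else 0 := by simp
  rw [eq_sub_iff_add_eq, hdiag, ← Finset.sum_add_distrib]
  refine Finset.sum_congr rfl fun j _ => ?_
  split_ifs <;> simp

lemma sum_mul_self_of_sign {n : ℕ} {m : Fin n → ℤ} (hm : ∀ i, m i = 1 ∨ m i = -1) :
    ∑ i, (m i : ℝ) * (m i : ℝ) = n := by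
  have h : ∀ i, (m i : ℝ) * (m i : ℝ) = 1 := fun i => by
    rcases hm i with h | h <;> simp [h]
  simp [h]

/-- The difference of two sums of signs is even. -/
lemma exists_oneBodySym_sub_eq {n : ℕ} {m m' : Fin n → ℤ}
    (hm : ∀ i, m i = 1 ∨ m i = -1) (hm' : ∀ i, m' i = 1 ∨ m' i = -1) :
    ∃ k : ℤ, oneBodySym n m - oneBodySym n m' = 2 * (k : ℝ) := by
  have h : (2 : ℤ) ∣ ∑ i, (m i - m' i) := Finset.dvd_sum fun i _ => by
    rcases hm i with h | h <;> rcases hm' i with h' | h' <;> simp [h, h']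
  obtain ⟨k, hk⟩ := h
  refine ⟨k, ?_⟩
  unfold oneBodySym
  rw [← Finset.sum_sub_distrib]
  exact_mod_cast hk

/-- The sum of `(1 - m i) * (1 - m' i)` is nonnegative, in expanded form. -/
lemma oneBodySym_add_le {n : ℕ} {m m' : Fin n → ℤ}
    (hm : ∀ i, m i = 1 ∨ m i = -1) (hm' : ∀ i, m' i = 1 ∨ m' i = -1) :
    oneBodySym n m + oneBodySym n m' ≤ n + ∑ i, (m i : ℝ) * (m' i : ℝ) := by
  have h : ∑ i, ((m i : ℝ) + m' i) ≤ ∑ i, (1 + (m i : ℝ) * m' i) :=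
    Finset.sum_le_sum fun i _ => by
      rcases hm i with h | h <;> rcases hm' i with h' | h' <;> norm_num [h, h']
  simpa [oneBodySym, Finset.sum_add_distrib] using h

/-- **Classical bound for the symmetric two-body Bell inequality**
`−2S₀ + (1/2)S₀₀ − S₀₁ + (1/2)S₁₁ + 2n ≥ 0`: it holds for every deterministic
local strategy `m₀, m₁ : Fin n → {−1,+1}` in the `(n,2,2)` scenario. -/
theorem classical_bound_symmetric_two_body (n : ℕ) (hn : 1 ≤ n)
    (m₀ m₁ : Fin n → ℤ)
    (hm₀ : ∀ i, m₀ i = 1 ∨ m₀ i = -1) (hm₁ : ∀ i, m₁ i = 1 ∨ m₁ i = -1) :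
    -2 * oneBodySym n m₀ + 1 / 2 * twoBodySym n m₀ m₀ - twoBodySym n m₀ m₁
        + 1 / 2 * twoBodySym n m₁ m₁ + 2 * (n : ℝ) ≥ 0 := by
  obtain ⟨k, hk⟩ := exists_oneBodySym_sub_eq hm₀ hm₁
  have hle := oneBodySym_add_le hm₀ hm₁
  have hkk : (k : ℝ) ≤ (k : ℝ) ^ 2 := by exact_mod_cast Int.le_self_sq k
  rw [twoBodySym_eq, twoBodySym_eq, twoBodySym_eq, sum_mul_self_of_sign hm₀,
    sum_mul_self_of_sign hm₁]
  have hsq : (oneBodySym n m₀ - oneBodySym n m₁) ^ 2 = 4 * (k : ℝ) ^ 2 := by rw [hk]; ring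
  linarith
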